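/- arXiv:2512.13705 — 3 statements merged into one kernel-verified Lean document; each statement's English description precedes it below -/
import Mathlib

section
/- Let E be a real vector space, let T ≥ 1 be a natural number, let z_1, …, z_T be vectors in E, and let ω_1, …, ω_T be non-negative real weights with ω_{1:T} := ω_1 + ⋯ + ω_T > 0. Define Δ_t = z_{t+1} − z_t for 1 ≤ t ≤ T−1, and define the sequence x_1, …, x_T by x_1 = z_1 and x_{t+1} = x_t + (ω_{t+1:T}/ω_{1:T}) Δ_t for 1 ≤ t ≤ T−1, where ω_{t+1:T} := ω_{t+1} + ⋯ + ω_T. Then the final iterate satisfies x_T = (1/ω_{1:T}) · Σ_{t=1}^T ω_t z_t, i.e. x_T equals the ω-weighted average of z_1, …, z_T. -/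
/-- Splitting off the first term of a sum over a closed interval of naturals. -/
theorem sum_Icc_eq_add_sum_Icc_succ {M : Type*} [AddCommMonoid M] (f : ℕ → M) {a b : ℕ}
    (hab : a ≤ b) :
    ∑ s ∈ Finset.Icc a b, f s = f a + ∑ s ∈ Finset.Icc (a + 1) b, f s := by
  rw [← Finset.insert_Icc_add_one_left_eq_Icc hab, Finset.sum_insert (by simp)]

/-- At every step, the total weight times the iterate is the weighted sum of the points seen
so far, with all the remaining weight placed on the current point. -/
theorem total_weight_smul_iterate
    {E : Type*} [AddCommGroup E] [Module ℝ E]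
    (T : ℕ) (z x : ℕ → E) (ω : ℕ → ℝ)
    (hW : ∑ t ∈ Finset.Icc 1 T, ω t ≠ 0)
    (hx1 : x 1 = z 1)
    (hx : ∀ t, 1 ≤ t → t < T →
      x (t + 1) = x t +
        ((∑ s ∈ Finset.Icc (t + 1) T, ω s) / (∑ s ∈ Finset.Icc 1 T, ω s)) •
          (z (t + 1) - z t))
    (t : ℕ) (ht : 1 ≤ t) (htT : t ≤ T) :
    (∑ s ∈ Finset.Icc 1 T, ω s) • x t =
      ∑ s ∈ Finset.Icc 1 t, ω s • z s + (∑ s ∈ Finset.Icc (t + 1) T, ω s) • z t := by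
  induction t, ht using Nat.le_induction with
  | base => rw [hx1, sum_Icc_eq_add_sum_Icc_succ ω htT, add_smul]; simp
  | succ t ht ih =>
    rw [hx t ht htT, smul_add, ih (Nat.le_of_succ_le htT), smul_smul, mul_div_cancel₀ _ hW,
      Finset.sum_Icc_succ_top (Nat.le_add_left 1 t), sum_Icc_eq_add_sum_Icc_succ ω htT]
    module

/-- The interpolated sequence `x` built from `z` with non-negative weights `ω`
has final iterate equal to the `ω`-weighted average of `z_1, …, z_T`. -/
theorem final_iterate_eq_weighted_average
    {E : Type*} [AddCommGroup E] [Module ℝ E]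
    (T : ℕ) (hT : 1 ≤ T)
    (z x : ℕ → E) (ω : ℕ → ℝ)
    (hω : ∀ t ∈ Finset.Icc 1 T, 0 ≤ ω t)
    (hW : 0 < ∑ t ∈ Finset.Icc 1 T, ω t)
    (hx1 : x 1 = z 1)
    (hx : ∀ t, 1 ≤ t → t < T →
      x (t + 1) = x t +
        ((∑ s ∈ Finset.Icc (t + 1) T, ω s) / (∑ s ∈ Finset.Icc 1 T, ω s)) •
          (z (t + 1) - z t)) :
    x T = (∑ t ∈ Finset.Icc 1 T, ω t)⁻¹ • ∑ t ∈ Finset.Icc 1 T, ω t • z t := by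
  rw [eq_inv_smul_iff₀ hW.ne', total_weight_smul_iterate T z x ω hW.ne' hx1 hx T hT le_rfl]
  simp
end

section
/- (Additive Reduction to Last Iterate, deterministic form.) Let E be a real inner product space and let f : E → ℝ be a convex function. Let T ≥ 1, let z_1, …, z_T be vectors in E, and let ω_1, …, ω_T be non-negative real weights with ω_{1:T} := ω_1 + ⋯ + ω_T > 0. For each t, let g_t ∈ E be a subgradient of f at z_t, i.e. f(y) ≥ f(z_t) + ⟨g_t, y − z_t⟩ for all y ∈ E. Define Δ_t = z_{t+1} − z_t, x_1 = z_1, and x_{t+1} = x_t + (ω_{t+1:T}/ω_{1:T}) Δ_t for 1 ≤ t ≤ T−1. Then for any comparator u ∈ E, f(x_T) − f(u) ≤ (1/ω_{1:T}) · Σ_{t=1}^T ω_t ⟨g_t, z_t − u⟩. -/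
open scoped RealInnerProductSpace

/-- Abel summation identity for the interpolated sequence: the scaled iterate `x k` is the weighted
sum of `z 1, …, z k` in which `z k` also carries all the remaining weight. -/
theorem sum_smul_interpolated_eq {E : Type*} [AddCommGroup E] [Module ℝ E] {T : ℕ}
    {z x : ℕ → E} {ω : ℕ → ℝ} (hW : ∑ t ∈ Finset.Icc 1 T, ω t ≠ 0) (hx1 : x 1 = z 1)
    (hx : ∀ t, 1 ≤ t → t < T →
      x (t + 1) = x t +
        ((∑ s ∈ Finset.Icc (t + 1) T, ω s) / (∑ s ∈ Finset.Icc 1 T, ω s)) •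
          (z (t + 1) - z t))
    {k : ℕ} (hk : 1 ≤ k) (hkT : k ≤ T) :
    (∑ t ∈ Finset.Icc 1 T, ω t) • x k =
      ∑ t ∈ Finset.Icc 1 k, ω t • z t + (∑ t ∈ Finset.Icc (k + 1) T, ω t) • z k := by
  have split {a : ℕ} (ha : a ≤ T) :
      ∑ t ∈ Finset.Icc a T, ω t = ω a + ∑ t ∈ Finset.Icc (a + 1) T, ω t := by
    rw [Finset.Icc_add_one_left_eq_Ioc, Finset.add_sum_Ioc_eq_sum_Icc ha]
  induction k, hk using Nat.le_induction with
  | base => rw [hx1, split hkT, Finset.Icc_self, Finset.sum_singleton, add_smul]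
  | succ k hk ih =>
    rw [hx k hk (by lia), smul_add, ih (by lia), smul_smul, mul_div_cancel₀ _ hW,
      Finset.sum_Icc_succ_top (by lia), split hkT]
    module

/-- Additive Reduction to Last Iterate (deterministic form): for a convex `f`,
subgradients `g t` of `f` at `z t`, and the interpolated sequence `x`, the
suboptimality of the final iterate `x T` against any comparator `u` is bounded
by the weighted average of the linearized regret terms. -/
theorem additive_reduction_last_iterate
    {E : Type*} [NormedAddCommGroup E] [InnerProductSpace ℝ E]
    (f : E → ℝ) (hf : ConvexOn ℝ Set.univ f)
    (T : ℕ) (hT : 1 ≤ T)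
    (z x g : ℕ → E) (ω : ℕ → ℝ)
    (hω : ∀ t ∈ Finset.Icc 1 T, 0 ≤ ω t)
    (hW : 0 < ∑ t ∈ Finset.Icc 1 T, ω t)
    (hg : ∀ t ∈ Finset.Icc 1 T, ∀ y : E, f (z t) + ⟪g t, y - z t⟫ ≤ f y)
    (hx1 : x 1 = z 1)
    (hx : ∀ t, 1 ≤ t → t < T →
      x (t + 1) = x t +
        ((∑ s ∈ Finset.Icc (t + 1) T, ω s) / (∑ s ∈ Finset.Icc 1 T, ω s)) •
          (z (t + 1) - z t))
    (u : E) :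
    f (x T) - f u ≤
      (∑ t ∈ Finset.Icc 1 T, ω t)⁻¹ *
        ∑ t ∈ Finset.Icc 1 T, ω t * ⟪g t, z t - u⟫ := by
  have hxT : x T = (Finset.Icc 1 T).centerMass ω z := by
    have h := sum_smul_interpolated_eq hW.ne' hx1 hx hT le_rfl
    rw [Finset.Icc_eq_empty (by lia : ¬ T + 1 ≤ T), Finset.sum_empty, zero_smul, add_zero] at h
    rw [Finset.centerMass, ← h, inv_smul_smul₀ hW.ne']
  have hJensen := hf.map_centerMass_le hω hW fun t _ => Set.mem_univ (z t)
  have hregret : ∑ t ∈ Finset.Icc 1 T, ω t * (f (z t) - f u) ≤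
      ∑ t ∈ Finset.Icc 1 T, ω t * ⟪g t, z t - u⟫ := by
    refine Finset.sum_le_sum fun t ht => mul_le_mul_of_nonneg_left ?_ (hω t ht)
    have h := hg t ht u
    rw [← neg_sub (z t) u, inner_neg_right] at h
    linarith
  calc f (x T) - f u ≤ (Finset.Icc 1 T).centerMass ω (f ∘ z) - f u := by
        rw [hxT]
        exact sub_le_sub_right hJensen _
    _ = (∑ t ∈ Finset.Icc 1 T, ω t)⁻¹ * ∑ t ∈ Finset.Icc 1 T, ω t * (f (z t) - f u) := by
        simp only [Finset.centerMass, smul_eq_mul, Function.comp_apply, mul_sub,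
          Finset.sum_sub_distrib, ← Finset.sum_mul]
        rw [inv_mul_cancel_left₀ hW.ne']
    _ ≤ _ := mul_le_mul_of_nonneg_left hregret (inv_nonneg.mpr hW.le)
end

section
/- (Last-iterate convergence of subgradient descent with linear decay schedule.) Let E be a real inner product space, let f : E → ℝ be a convex function, and let x* ∈ E be a minimizer of f. Let T ≥ 1 and let D, G > 0. Set γ = D/(G√T). Define z_1 ∈ E with ‖z_1 − x*‖ ≤ D, and recursively z_{t+1} = z_t − γ g_t for 1 ≤ t ≤ T−1, where each g_t is a subgradient of f at z_t and ‖g_t‖ ≤ G for all 1 ≤ t ≤ T. Define x_1 = z_1 and x_{t+1} = x_t − η_t g_t with η_t = (D/(G√T))·(1 − t/T) for 1 ≤ t ≤ T−1. Then the final iterate satisfies f(x_T) − f(x*) ≤ D·G/√T. -/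
open scoped RealInnerProductSpace

/-- One step of subgradient descent: the suboptimality at `z` is controlled by the decrease of the
squared distance to the comparison point `u`. -/
lemma two_mul_subgradient_step_le {E : Type*} [NormedAddCommGroup E] [InnerProductSpace ℝ E]
    {f : E → ℝ} {z g u : E} {γ G : ℝ} (hγ : 0 ≤ γ) (hg : f z + ⟪g, u - z⟫ ≤ f u) (hG : ‖g‖ ≤ G) :
    2 * γ * (f z - f u) + ‖z - γ • g - u‖ ^ 2 ≤ ‖z - u‖ ^ 2 + γ ^ 2 * G ^ 2 := by
  have hexp : ‖z - γ • g - u‖ ^ 2 = ‖z - u‖ ^ 2 + 2 * γ * ⟪g, u - z⟫ + γ ^ 2 * ‖g‖ ^ 2 := by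
    have hzu : z - γ • g - u = (z - u) - γ • g := by abel
    have hneg : u - z = -(z - u) := by abel
    rw [hzu, hneg, norm_sub_sq_real, inner_smul_right, inner_neg_right, norm_smul, mul_pow,
      Real.norm_eq_abs, sq_abs, real_inner_comm]
    ring
  have hsq : γ ^ 2 * ‖g‖ ^ 2 ≤ γ ^ 2 * G ^ 2 := by gcongr
  have hstep := mul_le_mul_of_nonneg_left hg (by positivity : 0 ≤ 2 * γ)
  rw [hexp]
  linarith

/-- Regret bound for subgradient descent with constant step size `γ`. -/
lemma two_mul_sum_subgradient_regret_le {E : Type*} [NormedAddCommGroup E] [InnerProductSpace ℝ E]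
    {f : E → ℝ} {z g : ℕ → E} {u : E} {γ G : ℝ} {T : ℕ} (hT : 1 ≤ T) (hγ : 0 ≤ γ)
    (hg : ∀ t ∈ Finset.Icc 1 T, f (z t) + ⟪g t, u - z t⟫ ≤ f u)
    (hG : ∀ t ∈ Finset.Icc 1 T, ‖g t‖ ≤ G)
    (hz : ∀ t, 1 ≤ t → t < T → z (t + 1) = z t - γ • g t) :
    2 * γ * ∑ t ∈ Finset.Icc 1 T, (f (z t) - f u) ≤ ‖z 1 - u‖ ^ 2 + T * (γ ^ 2 * G ^ 2) := by
  have key : ∀ n, 1 ≤ n → n ≤ T →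
      2 * γ * ∑ t ∈ Finset.Icc 1 n, (f (z t) - f u) + ‖z n - γ • g n - u‖ ^ 2
        ≤ ‖z 1 - u‖ ^ 2 + n * (γ ^ 2 * G ^ 2) := by
    intro n hn
    induction n, hn using Nat.le_induction with
    | base =>
      intro h
      have hmem : 1 ∈ Finset.Icc 1 T := Finset.mem_Icc.2 ⟨le_rfl, h⟩
      simpa using two_mul_subgradient_step_le hγ (hg 1 hmem) (hG 1 hmem)
    | succ n hn ih =>
      intro h
      have hmem : n + 1 ∈ Finset.Icc 1 T := Finset.mem_Icc.2 ⟨by omega, h⟩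
      have hstep := two_mul_subgradient_step_le hγ (hg _ hmem) (hG _ hmem)
      have hprev := ih (by omega)
      rw [← hz n hn (by omega)] at hprev
      rw [Finset.sum_Icc_succ_top (by omega)]
      push_cast
      linarith
  linarith [key T hT le_rfl, sq_nonneg ‖z T - γ • g T - u‖]

/-- The last iterate of the linearly decaying schedule is the average of the iterates of the
constant schedule driven by the same directions. -/
lemma linear_decay_eq_average {E : Type*} [AddCommGroup E] [Module ℝ E]
    {z x g : ℕ → E} {γ : ℝ} {T : ℕ} (hT : 1 ≤ T)
    (hz : ∀ t, 1 ≤ t → t < T → z (t + 1) = z t - γ • g t)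
    (hx1 : x 1 = z 1)
    (hx : ∀ t, 1 ≤ t → t < T → x (t + 1) = x t - (γ * (1 - (t : ℝ) / T)) • g t) :
    x T = ∑ t ∈ Finset.Icc 1 T, (T : ℝ)⁻¹ • z t := by
  have hT0 : (T : ℝ) ≠ 0 := by positivity
  have key : ∀ n, 1 ≤ n → n ≤ T →
      (T : ℝ) • x n = ∑ t ∈ Finset.Icc 1 n, z t + ((T : ℝ) - n) • z n := by
    intro n hn
    induction n, hn using Nat.le_induction with
    | base =>
      intro _
      simp only [Finset.Icc_self, Finset.sum_singleton, hx1, Nat.cast_one]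
      module
    | succ n hn ih =>
      intro h
      have hcoef : (T : ℝ) * (γ * (1 - (n : ℝ) / T)) = (T - n) * γ := by field_simp
      rw [Finset.sum_Icc_succ_top (by omega), hx n hn (by omega), smul_sub, ih (by omega),
        smul_smul, hcoef, hz n hn (by omega)]
      push_cast
      module
  have hlast := key T hT le_rfl
  rw [sub_self, zero_smul, add_zero] at hlast
  rw [← Finset.smul_sum, ← hlast, inv_smul_smul₀ hT0]

/-- Last-iterate convergence of subgradient descent with the linear decay
schedule `η_t = (D/(G√T))(1 − t/T)`: starting within distance `D` of a
minimizer `x*` of a convex `f`, with subgradients of norm at most `G`, the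
final iterate satisfies `f (x T) − f x* ≤ D G / √T`. -/
theorem linear_decay_last_iterate_convergence
    {E : Type*} [NormedAddCommGroup E] [InnerProductSpace ℝ E]
    (f : E → ℝ) (hf : ConvexOn ℝ Set.univ f)
    (xstar : E) (hmin : ∀ y : E, f xstar ≤ f y)
    (T : ℕ) (hT : 1 ≤ T)
    (D G : ℝ) (hD : 0 < D) (hG : 0 < G)
    (z x g : ℕ → E)
    (hz1 : ‖z 1 - xstar‖ ≤ D)
    (hg : ∀ t ∈ Finset.Icc 1 T, ∀ y : E, f (z t) + ⟪g t, y - z t⟫ ≤ f y)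
    (hgnorm : ∀ t ∈ Finset.Icc 1 T, ‖g t‖ ≤ G)
    (hz : ∀ t, 1 ≤ t → t < T →
      z (t + 1) = z t - (D / (G * Real.sqrt T)) • g t)
    (hx1 : x 1 = z 1)
    (hx : ∀ t, 1 ≤ t → t < T →
      x (t + 1) = x t - (D / (G * Real.sqrt T) * (1 - (t : ℝ) / T)) • g t) :
    f (x T) - f xstar ≤ D * G / Real.sqrt T := by
  have hT0 : (0 : ℝ) < T := by positivity
  have hγ : 0 < D / (G * Real.sqrt T) := by positivity
  have hregret := two_mul_sum_subgradient_regret_le hT hγ.le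
    (fun t ht => hg t ht xstar) hgnorm hz
  have hjensen : f (x T) ≤ ∑ t ∈ Finset.Icc 1 T, (T : ℝ)⁻¹ * f (z t) := by
    rw [linear_decay_eq_average hT hz hx1 hx]
    exact hf.map_sum_le (fun _ _ => by positivity) (by simp [hT0.ne']) (by simp)
  rw [← Finset.mul_sum] at hjensen
  rw [Finset.sum_sub_distrib, Finset.sum_const, Nat.card_Icc, Nat.add_sub_cancel,
    nsmul_eq_mul] at hregret
  have hdist : ‖z 1 - xstar‖ ^ 2 ≤ D ^ 2 := by gcongr
  have hsqrt : Real.sqrt T ^ 2 = T := Real.sq_sqrt hT0.le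
  set S := ∑ t ∈ Finset.Icc 1 T, f (z t)
  have hrhs : D ^ 2 + T * ((D / (G * Real.sqrt T)) ^ 2 * G ^ 2)
      = 2 * (D / (G * Real.sqrt T)) * (D * G * Real.sqrt T) := by
    rw [div_pow, mul_pow, hsqrt]
    field_simp
    ring
  have hsum : S - T * f xstar ≤ D * G * Real.sqrt T :=
    le_of_mul_le_mul_left (by linarith) (by positivity : 0 < 2 * (D / (G * Real.sqrt T)))
  calc f (x T) - f xstar ≤ (T : ℝ)⁻¹ * S - f xstar := by linarith
    _ = (T : ℝ)⁻¹ * (S - T * f xstar) := by field_simp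
    _ ≤ (T : ℝ)⁻¹ * (D * G * Real.sqrt T) := by gcongr
    _ = D * G / Real.sqrt T := by
      nth_rewrite 1 [← hsqrt]
      field_simp
end
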